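/- Let ℙ be a multiplicative subsemigroup of the positive integers containing some element p > 1. Every simple ℙ-torsion-free cone admits a strongly unitary embedding into a simple ℙ-torsion-free quasi-divisible refinement cone. -/

import Mathlib

universe u

/-- Conical commutative monoid ("cone"): `x + y = 0` implies `x = y = 0`. -/
def IsConical (M : Type u) [AddCommMonoid M] : Prop :=
  ∀ x y : M, x + y = 0 → x = 0 ∧ y = 0

/-- Algebraic preorder: `x ≤ y` iff `∃ z, x + z = y`. -/
def AlgLE {M : Type u} [AddCommMonoid M] (x y : M) : Prop :=
  ∃ z : M, x + z = y

/-- Refinement monoid. -/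
def IsRefinementMonoid (M : Type u) [AddCommMonoid M] : Prop :=
  ∀ a₀ a₁ b₀ b₁ : M, a₀ + a₁ = b₀ + b₁ →
    ∃ c₀₀ c₀₁ c₁₀ c₁₁ : M,
      a₀ = c₀₀ + c₀₁ ∧ a₁ = c₁₀ + c₁₁ ∧ b₀ = c₀₀ + c₁₀ ∧ b₁ = c₀₁ + c₁₁

/-- Unitary homomorphism: injective, cofinal image, and `f a₀ + b = f a₁ → b ∈ range f`. -/
def IsUnitary {A : Type u} {B : Type u} [AddCommMonoid A] [AddCommMonoid B]
    (f : A →+ B) : Prop :=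
  Function.Injective f ∧
  (∀ b : B, ∃ a : A, AlgLE b (f a)) ∧
  (∀ a₀ a₁ : A, ∀ b : B, f a₀ + b = f a₁ → b ∈ Set.range f)

/-- Strongly unitary homomorphism. -/
def IsStronglyUnitary {A : Type u} {B : Type u} [AddCommMonoid A] [AddCommMonoid B]
    (f : A →+ B) : Prop :=
  IsUnitary f ∧ ∀ m : ℕ, 0 < m → ∀ b : B, m • b ∈ Set.range f → b ∈ Set.range f

/-- Normally divisible commutative monoid. -/
def IsNormallyDivisible (M : Type u) [AddCommMonoid M] : Prop :=
  ∀ p : ℕ, 0 < p → ∀ X : Finset M, ∀ a : M,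
    ∃ u : M, p • u = a ∧ ∀ x ∈ X, ∀ y ∈ X, x + a = y + a → x + u = y + u

/-- Order-embedding of commutative monoids (w.r.t. the algebraic preorders). -/
def IsOrderEmbeddingHom {A : Type u} {B : Type u} [AddCommMonoid A] [AddCommMonoid B]
    (f : A →+ B) : Prop :=
  Function.Injective f ∧ ∀ x y : A, AlgLE x y ↔ AlgLE (f x) (f y)

/-- Simple commutative monoid: every `u ≰ 0` is an order-unit. -/
def IsSimpleMonoid (M : Type u) [AddCommMonoid M] : Prop :=
  ∀ u : M, ¬ AlgLE u 0 → ∀ x : M, ∃ n : ℕ, 0 < n ∧ AlgLE x (n • u)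

/-- Weak sum decomposition axiom (WSD). -/
def WSD (M : Type u) [AddCommMonoid M] : Prop :=
  ∀ a₀ a₁ b c : M, a₀ + a₁ + c = b + c →
    ∃ x₀ x₁ : M, a₀ + c = x₀ + c ∧ a₁ + c = x₁ + c ∧ b = x₀ + x₁

/-- `a ∝ b` : `a ≤ n • b` for some positive integer `n`. -/
def Propto {M : Type u} [AddCommMonoid M] (a b : M) : Prop :=
  ∃ n : ℕ, 0 < n ∧ AlgLE a (n • b)

/-- `a ≍ b` : `a ∝ b` and `b ∝ a`. -/
def Asymp {M : Type u} [AddCommMonoid M] (a b : M) : Prop :=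
  Propto a b ∧ Propto b a

/-- Cancellative commutative monoid. -/
def IsCancellativeMonoid (M : Type u) [AddCommMonoid M] : Prop :=
  ∀ x y z : M, x + z = y + z → x = y

/-- Separative commutative monoid. -/
def IsSeparative (M : Type u) [AddCommMonoid M] : Prop :=
  ∀ x y : M, 2 • x = x + y → x + y = 2 • y → x = y

/-- Stably finite commutative monoid. -/
def IsStablyFinite (M : Type u) [AddCommMonoid M] : Prop :=
  ∀ x y : M, x + y = y → x = 0

/-- Quasi-divisible commutative monoid. -/
def IsQuasiDivisible (M : Type u) [AddCommMonoid M] : Prop :=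
  ∀ x : M, ∃ u v : M, 2 • u + 3 • v = x

/-- `ℙ`-torsion-free commutative monoid. -/
def PTorsionFree (P : Set ℕ) (M : Type u) [AddCommMonoid M] : Prop :=
  ∀ p ∈ P, ∀ x y : M, p • x = p • y → x = y

/-- `ℙ`-unperforated commutative monoid (w.r.t. the algebraic preorder). -/
def PUnperforated (P : Set ℕ) (M : Type u) [AddCommMonoid M] : Prop :=
  ∀ p ∈ P, ∀ x y : M, AlgLE (p • x) (p • y) → AlgLE x y

universe v

section Generalities

variable {M : Type u} [AddCommMonoid M]

theorem IsConical.nsmul_ne_zero (hM : IsConical M) {x : M} (hx : x ≠ 0) {n : ℕ} (hn : 0 < n) :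
    n • x ≠ 0 := by
  obtain ⟨m, rfl⟩ : ∃ m, n = m + 1 := ⟨n - 1, by omega⟩
  intro h
  rw [succ_nsmul] at h
  exact hx (hM _ _ h).2

theorem IsConical.add_ne_zero_left (hM : IsConical M) {x : M} (hx : x ≠ 0) (y : M) :
    x + y ≠ 0 := fun h => hx (hM _ _ h).1

theorem IsConical.add_ne_zero_right (hM : IsConical M) {y : M} (hy : y ≠ 0) (x : M) :
    x + y ≠ 0 := fun h => hy (hM _ _ h).2

theorem IsConical.not_algLE_zero_iff (hM : IsConical M) {x : M} : ¬ AlgLE x 0 ↔ x ≠ 0 := by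
  refine not_congr ⟨fun ⟨y, h⟩ => (hM _ _ h).1, ?_⟩
  rintro rfl
  exact ⟨0, add_zero 0⟩

theorem AlgLE.trans {x y z : M} (h₁ : AlgLE x y) (h₂ : AlgLE y z) : AlgLE x z := by
  obtain ⟨a, rfl⟩ := h₁
  obtain ⟨b, rfl⟩ := h₂
  exact ⟨a + b, (add_assoc _ _ _).symm⟩

theorem AlgLE.nsmul {x y : M} (h : AlgLE x y) (n : ℕ) : AlgLE (n • x) (n • y) := by
  obtain ⟨a, rfl⟩ := h
  exact ⟨n • a, (nsmul_add _ _ _).symm⟩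

theorem AlgLE.map {N : Type v} [AddCommMonoid N] {x y : M} (h : AlgLE x y) (f : M →+ N) :
    AlgLE (f x) (f y) := by
  obtain ⟨a, rfl⟩ := h
  exact ⟨f a, (map_add _ _ _).symm⟩

theorem IsStronglyUnitary.id : IsStronglyUnitary (AddMonoidHom.id M) :=
  ⟨⟨Function.injective_id, fun b => ⟨b, 0, add_zero b⟩, fun _ _ b _ => ⟨b, rfl⟩⟩,
    fun _ _ b _ => ⟨b, rfl⟩⟩

theorem IsStronglyUnitary.comp {N L : Type u} [AddCommMonoid N] [AddCommMonoid L]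
    {g : N →+ L} {f : M →+ N} (hg : IsStronglyUnitary g) (hf : IsStronglyUnitary f) :
    IsStronglyUnitary (g.comp f) := by
  obtain ⟨⟨gi, gc, gu⟩, gs⟩ := hg
  obtain ⟨⟨fi, fc, fu⟩, fs⟩ := hf
  refine ⟨⟨gi.comp fi, fun b => ?_, fun a₀ a₁ b h => ?_⟩, fun m hm b h => ?_⟩
  · obtain ⟨c, hc⟩ := gc b
    obtain ⟨a, ha⟩ := fc c
    exact ⟨a, hc.trans (ha.map g)⟩
  · obtain ⟨c, rfl⟩ := gu _ _ _ h
    obtain ⟨a, rfl⟩ := fu a₀ a₁ c (gi (by simpa using h))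
    exact ⟨a, rfl⟩
  · obtain ⟨a, ha⟩ := h
    obtain ⟨c, rfl⟩ := gs m hm b ⟨f a, ha⟩
    obtain ⟨a', rfl⟩ := fs m hm c ⟨a, gi (by simpa using ha)⟩
    exact ⟨a', rfl⟩

end Generalities

/-- A commutative monoid `K` graded by `deg`, together with a value in `M` for each element of
degree zero, in such a way that adjoining `K` to `M` yields a simple cone in which the elements of
degree zero are identified with their values. -/
structure GradedExt {M : Type u} [AddCommMonoid M] {K V : Type*} [AddCommMonoid K]
    [AddCommGroup V] (deg : K →+ V) (val : K → M) : Prop where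
  val_zero : val 0 = 0
  val_add : ∀ s t, deg s = 0 → deg t = 0 → val (s + t) = val s + val t
  val_ne_zero : ∀ s t, deg s ≠ 0 → deg (s + t) = 0 → val (s + t) ≠ 0
  exists_nsmul : ∀ t, deg t ≠ 0 → ∃ k : ℕ, 0 < k ∧ ∃ u w, k • t = u + w ∧ deg u = 0 ∧ val u ≠ 0
  exists_neg : ∀ t, ∃ u, deg (t + u) = 0

namespace GradedExt

variable {M : Type u} [AddCommMonoid M]

section

variable {K V : Type*} [AddCommMonoid K] [AddCommGroup V] {deg : K →+ V} {val : K → M}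

theorem val_nsmul (h : GradedExt deg val) (n : ℕ) {t : K} (ht : deg t = 0) :
    val (n • t) = n • val t := by
  induction n with
  | zero => simp [h.val_zero]
  | succ n ih => rw [succ_nsmul, h.val_add _ _ (by simp [ht]) ht, ih, succ_nsmul]

theorem prod (hM : IsConical M) (h : GradedExt deg val) :
    GradedExt (deg.comp (AddMonoidHom.snd M K)) (fun t : M × K => t.1 + val t.2) where
  val_zero := by simp [h.val_zero]
  val_add := by
    rintro ⟨x, s⟩ ⟨y, t⟩ hs ht
    simp only [AddMonoidHom.comp_apply, AddMonoidHom.coe_snd] at hs ht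
    simp only [Prod.mk_add_mk, h.val_add s t hs ht]
    abel
  val_ne_zero := by
    rintro ⟨x, s⟩ ⟨y, t⟩ hs ht
    exact hM.add_ne_zero_right (h.val_ne_zero s t hs ht) _
  exists_nsmul := by
    rintro ⟨x, t⟩ ht
    obtain ⟨k, hk, u, w, e, hu, hv⟩ := h.exists_nsmul t ht
    refine ⟨k, hk, (0, u), (k • x, w), by simp [e], hu, ?_⟩
    simpa using hv
  exists_neg := by
    rintro ⟨x, t⟩
    obtain ⟨u, hu⟩ := h.exists_neg t
    exact ⟨(0, u), hu⟩

end

section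

variable {K V : Type*} [AddCommMonoid K] [AddCommGroup V]

/-- Two elements are identified when they have the same degree and cannot be told apart by the
values of their sums with elements of opposite degree. -/
def con (deg : K →+ V) (val : K → M) : AddCon K where
  r s t := deg s = deg t ∧ ∀ u, deg (s + u) = 0 → val (s + u) = val (t + u)
  iseqv :=
    { refl := fun _ => ⟨rfl, fun _ _ => rfl⟩
      symm := fun {s t} h => ⟨h.1.symm, fun u hu => (h.2 u (by simpa [h.1] using hu)).symm⟩
      trans := fun {s t r} h₁ h₂ => ⟨h₁.1.trans h₂.1, fun u hu =>
        (h₁.2 u hu).trans (h₂.2 u (by simpa [h₁.1] using hu))⟩ }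
  add' := by
    rintro s s' t t' ⟨h₁, h₂⟩ ⟨h₃, h₄⟩
    refine ⟨by simp [h₁, h₃], fun u hu => ?_⟩
    have e₁ := h₂ (t + u) (by simpa [add_assoc] using hu)
    have e₂ := h₄ (s' + u) (by
      simp only [map_add, h₁] at hu ⊢
      rw [← hu]
      abel)
    rw [add_assoc, e₁, add_left_comm, e₂]
    congr 1
    abel

end

variable {K : Type u} {V : Type*} [AddCommMonoid K] [AddCommGroup V] {deg : K →+ V} {val : K → M}

/-- Adjoining `K` to `M`. -/
theorem exists_extension [IsAddTorsionFree V] {P : Set ℕ} (hPpos : ∀ p ∈ P, 0 < p)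
    (hM : IsConical M) (hMs : IsSimpleMonoid M) (hMtf : PTorsionFree P M)
    (hK : GradedExt deg val) :
    ∃ (N : Type u) (_ : AddCommMonoid N), IsConical N ∧ IsSimpleMonoid N ∧ PTorsionFree P N ∧
      ∃ (f : M →+ N) (g : K →+ N), IsStronglyUnitary f ∧
        (∀ t, deg t = 0 → g t = f (val t)) ∧ ∀ t, deg t ≠ 0 → g t ≠ 0 := by
  set D : M × K →+ V := deg.comp (AddMonoidHom.snd M K) with hD
  set W : M × K → M := fun t => t.1 + val t.2 with hW
  have h : GradedExt D W := hK.prod hM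
  let c := con D W
  have hc : ∀ s t : M × K, (s : c.Quotient) = t ↔
      (D s = D t ∧ ∀ u, D (s + u) = 0 → W (s + u) = W (t + u)) := fun s t => c.eq
  have hDj : ∀ x : M, D (x, 0) = 0 := fun x => by simp [hD]
  have hWj : ∀ x : M, W (x, 0) = x := fun x => by simp [hW, hK.val_zero]
  let f : M →+ c.Quotient := c.mk'.comp (AddMonoidHom.inl M K)
  have hf : ∀ x, f x = ((x, 0) : M × K) := fun x => rfl
  have key : ∀ t, D t = 0 → (t : c.Quotient) = f (W t) := by
    intro t ht
    refine (hc _ _).2 ⟨by rw [ht]; exact (hDj _).symm, fun u hu => ?_⟩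
    have hu' : D u = 0 := by simpa [ht] using hu
    rw [h.val_add _ _ ht hu']
    refine Eq.trans ?_ (h.val_add _ _ (hDj _) hu').symm
    rw [hWj]
  have rep : ∀ b : c.Quotient, ∃ t : M × K, b = t := fun b => by
    induction b using AddCon.induction_on with
    | H t => exact ⟨t, rfl⟩
  have degf : ∀ (t : M × K) (a : M), (t : c.Quotient) = f a → D t = 0 := fun t a e =>
    ((hc _ _).1 e).1.trans (hDj a)
  have finj : Function.Injective f := by
    intro x y e
    have := ((hc _ _).1 e).2 0 (by rw [add_zero]; exact hDj x)
    simpa [hWj, hW, hK.val_zero] using this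
  have con : IsConical c.Quotient := by
    intro x y e
    obtain ⟨s, rfl⟩ := rep x
    obtain ⟨t, rfl⟩ := rep y
    have e' : ((s + t : M × K) : c.Quotient) = f 0 := by rw [map_zero]; exact e
    have hst := degf _ _ e'
    have hv : W (s + t) = 0 := by
      rw [key _ hst] at e'
      exact finj e'
    have hs : D s = 0 := by
      by_contra hs
      exact h.val_ne_zero s t hs hst hv
    have ht : D t = 0 := by simpa [hs] using hst
    rw [h.val_add _ _ hs ht] at hv
    rw [key _ hs, key _ ht, (hM _ _ hv).1, (hM _ _ hv).2, map_zero]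
    exact ⟨rfl, rfl⟩
  have cof : ∀ b : c.Quotient, ∃ a : M, AlgLE b (f a) := by
    intro b
    obtain ⟨t, rfl⟩ := rep b
    obtain ⟨u, hu⟩ := h.exists_neg t
    exact ⟨W (t + u), (u : c.Quotient), (key _ hu)⟩
  have big : ∀ b : c.Quotient, b ≠ 0 → ∃ k : ℕ, 0 < k ∧ ∃ a : M, a ≠ 0 ∧ AlgLE (f a) (k • b) := by
    intro b hb
    obtain ⟨t, rfl⟩ := rep b
    by_cases ht : D t = 0
    · refine ⟨1, one_pos, W t, fun h0 => hb ?_, 0, ?_⟩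
      · rw [key _ ht, h0, map_zero]
      · rw [one_nsmul, add_zero, key _ ht]
    · obtain ⟨k, hk, u, w, e, hu, hv⟩ := h.exists_nsmul t ht
      refine ⟨k, hk, W u, hv, (w : c.Quotient), ?_⟩
      rw [← key _ hu, ← AddCon.coe_add, ← e]
      rfl
  refine ⟨c.Quotient, inferInstance, con, ?_, ?_, f, c.mk'.comp (AddMonoidHom.inr M K),
    ⟨⟨finj, cof, ?_⟩, ?_⟩, ?_, ?_⟩
  · intro b hb x
    obtain ⟨k, hk, a, ha, hab⟩ := big b (con.not_algLE_zero_iff.1 hb)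
    obtain ⟨y, hy⟩ := cof x
    obtain ⟨n, hn, hny⟩ := hMs a (hM.not_algLE_zero_iff.2 ha) y
    refine ⟨n * k, Nat.mul_pos hn hk, hy.trans ((hny.map f).trans ?_)⟩
    rw [mul_nsmul', map_nsmul]
    exact hab.nsmul n
  · intro p hp x y e
    obtain ⟨s, rfl⟩ := rep x
    obtain ⟨t, rfl⟩ := rep y
    obtain ⟨e₁, e₂⟩ := (hc (p • s) (p • t)).1 e
    have hp0 : p ≠ 0 := (hPpos p hp).ne'
    have hst : D s = D t := by
      rw [map_nsmul, map_nsmul] at e₁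
      exact nsmul_right_injective hp0 e₁
    refine (hc _ _).2 ⟨hst, fun u hu => hMtf p hp _ _ ?_⟩
    rw [← h.val_nsmul p hu, ← h.val_nsmul p (t := t + u) (by simpa [hst] using hu),
      nsmul_add, nsmul_add]
    apply e₂
    rw [← nsmul_add, map_nsmul, hu, nsmul_zero]
  · intro a₀ a₁ b e
    obtain ⟨t, rfl⟩ := rep b
    have := degf ((a₀, 0) + t) a₁ e
    have ht : D t = 0 := by rwa [map_add, hDj, zero_add] at this
    exact ⟨_, (key t ht).symm⟩
  · rintro m hm b ⟨a, e⟩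
    obtain ⟨t, rfl⟩ := rep b
    have := degf (m • t) a e.symm
    rw [map_nsmul] at this
    have ht : D t = 0 := by simpa [hm.ne'] using this
    exact ⟨_, (key t ht).symm⟩
  · intro t ht
    refine (key (0, t) ht).trans ?_
    simp [hW]
  · intro t ht h0
    exact ht (degf (0, t) 0 (h0.trans (map_zero f).symm))

end GradedExt

/-- A bundled `GradedExt`, whose underlying monoid is a submonoid `S` of some `A : Type` and whose
degrees belong to `ℤ × ℤ`. -/
structure Gadget (M : Type u) [AddCommMonoid M] where
  A : Type
  [inst : AddCommMonoid A]
  S : AddSubmonoid A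
  deg : A →+ ℤ × ℤ
  val : A → M
  gradedExt : GradedExt (deg.comp S.subtype) (fun t : S => val t)

attribute [instance] Gadget.inst

namespace GradedExt

variable {M : Type u} [AddCommMonoid M] {I : Type u} {K : I → Type} {V : I → Type}
  [∀ i, AddCommMonoid (K i)] [∀ i, AddCommGroup (V i)] {deg : ∀ i, K i →+ V i}
  {val : ∀ i, K i → M}

/-- The componentwise degree on a direct sum. -/
def degSum (deg : ∀ i, K i →+ V i) : (Π₀ i, K i) →+ (∀ i, V i) where
  toFun t i := deg i (t i)
  map_zero' := by ext; simp
  map_add' s t := by ext; simp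

theorem degSum_single_eq_zero [DecidableEq I] {i : I} {t : K i} (ht : deg i t = 0) :
    degSum deg (DFinsupp.single i t) = 0 := by
  funext j
  change deg j (DFinsupp.single i t j) = 0
  by_cases hj : i = j
  · subst hj
    simpa using ht
  · simp [DFinsupp.single_eq_of_ne (Ne.symm hj)]

theorem finsum_single [DecidableEq I] (h₀ : ∀ i, val i 0 = 0) (i : I) (t : K i) :
    ∑ᶠ j, val j (DFinsupp.single i t j) = val i t := by
  rw [finsum_eq_single _ i, DFinsupp.single_eq_same]
  intro j hj
  rw [DFinsupp.single_eq_of_ne hj, h₀]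

theorem directSum (hM : IsConical M) (h : ∀ i, GradedExt (deg i) (val i)) :
    GradedExt (degSum deg) (fun t => ∑ᶠ i, val i (t i)) := by
  classical
  have h₀ : ∀ i, val i 0 = 0 := fun i => (h i).val_zero
  have hfin : ∀ t : Π₀ i, K i, Function.HasFiniteSupport fun i => val i (t i) := by
    intro t
    refine t.finite_support.subset fun i hi => ?_
    rintro (e : t i = 0)
    exact hi (by simp [e, h₀])
  have hadd : ∀ s t, degSum deg s = 0 → degSum deg t = 0 →
      ∑ᶠ i, val i ((s + t) i) = ∑ᶠ i, val i (s i) + ∑ᶠ i, val i (t i) := by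
    intro s t hs ht
    rw [← finsum_add_distrib (hfin s) (hfin t)]
    exact finsum_congr fun i => (h i).val_add _ _ (congrFun hs i) (congrFun ht i)
  refine ⟨by simp [h₀], hadd, ?_, ?_, ?_⟩
  · intro s t hs hst
    obtain ⟨i, hi⟩ := Function.ne_iff.1 hs
    have hi' : deg i ((s + t) i) = 0 := congrFun hst i
    have e := DFinsupp.single_add_erase i (s + t)
    have hd : degSum deg (DFinsupp.single i ((s + t) i)) = 0 := degSum_single_eq_zero hi'
    have hd' : degSum deg (DFinsupp.erase i (s + t)) = 0 := by
      have := hst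
      rw [← e, map_add, hd, zero_add] at this
      exact this
    have := hadd _ _ hd hd'
    rw [e, finsum_single h₀] at this
    rw [this]
    exact hM.add_ne_zero_left ((h i).val_ne_zero (s i) (t i) hi hi') _
  · intro t ht
    obtain ⟨i, hi⟩ := Function.ne_iff.1 ht
    obtain ⟨k, hk, u, w, e, hu, hv⟩ := (h i).exists_nsmul (t i) hi
    refine ⟨k, hk, DFinsupp.single i u, DFinsupp.single i w + k • DFinsupp.erase i t, ?_,
      degSum_single_eq_zero hu, ?_⟩
    · rw [← add_assoc, ← DFinsupp.single_add, ← e]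
      conv_lhs => rw [← DFinsupp.single_add_erase i t, nsmul_add]
      congr 1
      exact (map_nsmul (DFinsupp.singleAddHom K i) k (t i)).symm
    · rwa [finsum_single h₀]
  · intro t
    choose g hg using fun i => (h i).exists_neg
    refine ⟨t.mapRange (fun i x => if x = 0 then 0 else g i x) (fun i => if_pos rfl), ?_⟩
    funext i
    change deg i (t i + t.mapRange (fun i x => if x = 0 then 0 else g i x) _ i) = 0
    rw [DFinsupp.mapRange_apply]
    split_ifs with hti
    · simp [hti]
    · exact hg i _

end GradedExt

/-- All the members of a family of gadgets can be adjoined to a simple cone simultaneously. -/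
theorem Gadget.exists_extension {M : Type u} [AddCommMonoid M] {P : Set ℕ}
    (hPpos : ∀ p ∈ P, 0 < p) (hM : IsConical M) (hMs : IsSimpleMonoid M) (hMtf : PTorsionFree P M)
    {I : Type u} (G : I → Gadget M) :
    ∃ (N : Type u) (_ : AddCommMonoid N), IsConical N ∧ IsSimpleMonoid N ∧ PTorsionFree P N ∧
      ∃ f : M →+ N, IsStronglyUnitary f ∧ ∀ i, ∃ g : (G i).S →+ N,
        (∀ t : (G i).S, (G i).deg t = 0 → g t = f ((G i).val t)) ∧
        ∀ t : (G i).S, (G i).deg t ≠ 0 → g t ≠ 0 := by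
  classical
  have h := GradedExt.directSum hM fun i => (G i).gradedExt
  obtain ⟨N, hN, h₁, h₂, h₃, f, g, hf, hg, hg'⟩ := h.exists_extension hPpos hM hMs hMtf
  refine ⟨N, hN, h₁, h₂, h₃, f, hf, fun i =>
    ⟨g.comp (DFinsupp.singleAddHom (fun i => (G i).S) i), fun t ht => ?_, fun t ht => ?_⟩⟩
  · refine (hg _ (GradedExt.degSum_single_eq_zero ht)).trans ?_
    congr 1
    exact GradedExt.finsum_single (K := fun i => (G i).S) (val := fun i t => (G i).val t)
      (fun i => (G i).gradedExt.val_zero) i t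
  · refine hg' _ fun h0 => ht ?_
    have : (G i).deg (DFinsupp.single (β := fun i => (G i).S) i t i : (G i).S) = 0 := congrFun h0 i
    rwa [DFinsupp.single_eq_same] at this

namespace Gadget

variable {M : Type u} [AddCommMonoid M]

/-- The positive cone of `ℤ × ℤ` for the linear form `5 * k + n`. The element `(1, 0)`, valued `e`,
splits as `2 • (2, -9) + 3 • (-1, 6)`. -/
def splitting (hM : IsConical M) {e : M} (he : e ≠ 0) : Gadget M where
  A := ℤ × ℤ
  S :=
    { carrier := {t | t = 0 ∨ 0 < 5 * t.1 + t.2}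
      zero_mem' := Or.inl rfl
      add_mem' := by
        rintro s t (rfl | hs) (rfl | ht)
        · exact Or.inl (add_zero 0)
        · exact Or.inr (by simpa using ht)
        · exact Or.inr (by simpa using hs)
        · refine Or.inr ?_
          simp only [Prod.fst_add, Prod.snd_add]
          linarith }
  deg := (AddMonoidHom.inl ℤ ℤ).comp (AddMonoidHom.snd ℤ ℤ)
  val t := t.1.toNat • e
  gradedExt := by
    refine ⟨by simp, ?_, ?_, ?_, ?_⟩
    · rintro ⟨⟨k, n⟩, hs⟩ ⟨⟨k', n'⟩, hs'⟩ h h'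
      simp at h h' hs hs' ⊢
      rw [← add_nsmul]
      congr 1
      omega
    · rintro ⟨⟨k, n⟩, hs⟩ ⟨⟨k', n'⟩, hs'⟩ h h'
      simp at h h' hs hs' ⊢
      exact hM.nsmul_ne_zero he (by omega)
    · rintro ⟨⟨k, n⟩, hs⟩ h
      simp at h hs
      refine ⟨6, by norm_num, ⟨(1, 0), by simp⟩, ⟨(6 * k - 1, 6 * n), ?_⟩, ?_, ?_, ?_⟩
      · refine Or.inr ?_
        change 0 < 5 * (6 * k - 1) + 6 * n
        omega
      · ext <;> simp
      · simp
      · simpa using he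
    · rintro ⟨⟨k, n⟩, hs⟩
      refine ⟨⟨(1 + n ^ 2, -n), Or.inr ?_⟩, by simp⟩
      change 0 < 5 * (1 + n ^ 2) + -n
      nlinarith [sq_nonneg (n - 1)]

theorem lowerBound_val_eq {a b h : M} {p : ℕ} (hab : p • b = a + h) {i j : ℤ} {α β γ : ℕ}
    (hi : (α : ℤ) - γ = i) (hj : (β : ℤ) + p * γ = j) :
    i.toNat • a + (j - p * (-i).toNat).toNat • b + (-i).toNat • h = α • a + β • b + γ • h := by
  obtain ⟨δ, h₁, h₂⟩ : ∃ δ, α = i.toNat + δ ∧ γ = (-i).toNat + δ :=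
    ⟨α - i.toNat, by omega, by omega⟩
  have h₃ : (j - p * (-i).toNat).toNat = β + δ * p := by
    rw [← hj, h₂]
    have : ((β : ℤ) + p * (((-i).toNat + δ : ℕ) : ℤ) - p * (-i).toNat) = ((β + δ * p : ℕ) : ℤ) := by
      push_cast
      ring
    rw [this, Int.toNat_natCast]
  rw [h₃, h₁, h₂, add_nsmul b, mul_nsmul', hab]
  simp only [add_nsmul, nsmul_add]
  abel

/-- The elements `(1, 0, 0)` and `(0, 1, 0)` are valued `a` and `b`, where `p • b = a + h`, and
`(0, 0, 1)` is a common lower bound of both of them. -/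
def lowerBound (hM : IsConical M) {a b h : M} (ha : a ≠ 0) (hb : b ≠ 0) {p : ℕ} (hp : 0 < p)
    (hab : p • b = a + h) : Gadget M where
  A := ℤ × ℤ × ℤ
  S :=
    { carrier := {t | t = 0 ∨ 0 ≤ t.2.1 ∧ 0 < 2 * (p * t.1 + t.2.1) + t.2.2}
      zero_mem' := Or.inl rfl
      add_mem' := by
        rintro s t (rfl | hs) (rfl | ht)
        · exact Or.inl (add_zero 0)
        · exact Or.inr (by simpa using ht)
        · exact Or.inr (by simpa using hs)
        · refine Or.inr ?_
          simp only [Prod.fst_add, Prod.snd_add]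
          constructor <;> linarith }
  deg := (AddMonoidHom.inl ℤ ℤ).comp ((AddMonoidHom.snd ℤ ℤ).comp (AddMonoidHom.snd ℤ (ℤ × ℤ)))
  val t := t.1.toNat • a + (t.2.1 - p * (-t.1).toNat).toNat • b + (-t.1).toNat • h
  gradedExt := by
    have hmul : ∀ i j : ℤ, 0 ≤ j → 0 ≤ p * i + j →
        (((j - p * (-i).toNat).toNat : ℕ) : ℤ) + p * ((-i).toNat : ℕ) = j := by
      intro i j hj hij
      rw [Int.toNat_of_nonneg]
      · ring
      · rcases le_total 0 i with hi | hi
        · rw [Int.toNat_of_nonpos (by omega)]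
          simpa using hj
        · rw [Int.toNat_of_nonneg (by omega)]
          linarith
    refine ⟨by simp, ?_, ?_, ?_, ?_⟩
    · rintro ⟨⟨i, j, n⟩, hs⟩ ⟨⟨i', j', n'⟩, hs'⟩ e e'
      simp at e e' hs hs' ⊢
      have h₁ : 0 ≤ j ∧ 0 ≤ p * i + j := by
        rcases hs with ⟨rfl, rfl, _⟩ | hs
        · simp
        · exact ⟨hs.1, by linarith⟩
      have h₂ : 0 ≤ j' ∧ 0 ≤ p * i' + j' := by
        rcases hs' with ⟨rfl, rfl, _⟩ | hs'
        · simp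
        · exact ⟨hs'.1, by linarith⟩
      have q₁ := hmul i j h₁.1 h₁.2
      have q₂ := hmul i' j' h₂.1 h₂.2
      have := lowerBound_val_eq hab (i := i + i') (j := j + j')
        (α := i.toNat + i'.toNat)
        (β := (j - p * (-i).toNat).toNat + (j' - p * (-i').toNat).toNat)
        (γ := (-i).toNat + (-i').toNat) (by omega) (by push_cast at q₁ q₂ ⊢; linarith)
      rw [neg_add_rev] at this
      simp only [Int.ofNat_toNat] at this
      rw [this]
      simp only [add_nsmul]
      abel
    · rintro ⟨⟨i, j, n⟩, hs⟩ ⟨⟨i', j', n'⟩, hs'⟩ e e'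
      simp at e e' hs hs' ⊢
      have h₁ : 0 ≤ j ∧ 0 < 2 * (p * i + j) + n := by
        rcases hs with hs | hs
        · exact absurd hs.2.2 e
        · exact hs
      have h₂ : 0 ≤ j' ∧ 0 < 2 * (p * i' + j') + n' := by
        rcases hs' with hs | hs
        · omega
        · exact hs
      have h₃ : 0 < p * (i + i') + (j + j') := by linarith
      rcases lt_trichotomy (i + i') 0 with hi | hi | hi
      · have q := hmul (i + i') (j + j') (by omega) h₃.le
        refine hM.add_ne_zero_left (hM.add_ne_zero_right (hM.nsmul_ne_zero hb ?_) _) _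
        rw [neg_add_rev] at q
        simp only [Int.ofNat_toNat] at q
        rw [max_eq_left (by omega)] at q ⊢
        refine Int.lt_toNat.2 ?_
        push_cast
        linarith
      · refine hM.add_ne_zero_left (hM.add_ne_zero_right (hM.nsmul_ne_zero hb ?_) _) _
        rw [hi] at h₃
        rw [max_eq_right (by omega)]
        omega
      · exact hM.add_ne_zero_left (hM.add_ne_zero_left (hM.nsmul_ne_zero ha (by omega)) _) _
    · rintro ⟨⟨i, j, n⟩, hs⟩ e
      simp at e hs
      have h₁ : 0 ≤ j ∧ 0 < 2 * (p * i + j) + n := by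
        rcases hs with hs | hs
        · exact absurd hs.2.2 e
        · exact hs
      refine ⟨2 * p + 1, by omega, ⟨(1, 0, 0), Or.inr ⟨le_rfl, by simpa using hp⟩⟩,
        ⟨((2 * p + 1) * i - 1, (2 * p + 1) * j, (2 * p + 1) * n), Or.inr ⟨?_, ?_⟩⟩, ?_, ?_, ?_⟩
      · exact mul_nonneg (by positivity) h₁.1
      · change 0 < 2 * (p * ((2 * p + 1) * i - 1) + (2 * p + 1) * j) + (2 * p + 1) * n
        nlinarith
      · ext <;> simp
      · simp
      · simpa using ha
    · rintro ⟨⟨i, j, n⟩, hs⟩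
      refine ⟨⟨(0, 1 + n ^ 2, -n), Or.inr ⟨by positivity, ?_⟩⟩, by simp⟩
      change 0 < 2 * (p * 0 + (1 + n ^ 2)) + -n
      nlinarith [sq_nonneg (n - 1)]

end Gadget

namespace Gadget

variable {M : Type u} [AddCommMonoid M]

/-- The value of a `2 × 2` matrix that is a sum of rows valued `a₀`, `a₁` and columns valued `b₀`,
`b₁`, computed from the decomposition into rows and columns that uses as many rows as possible. -/
def matrixVal (a₀ a₁ b₀ b₁ : M) (m : ℕ × ℕ × ℕ × ℕ) : M :=
  min m.1 m.2.1 • a₀ + min m.2.2.1 m.2.2.2 • a₁ + (m.1 - m.2.1) • b₀ + (m.2.1 - m.1) • b₁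

theorem nsmul_add_eq_of_add_eq {x y c : M} (h : x + c = y + c) (n : ℕ) :
    n • x + c = n • y + c := by
  induction n with
  | zero => simp
  | succ n ih => rw [succ_nsmul, succ_nsmul, add_assoc, h, add_left_comm, ih, add_left_comm,
      add_assoc]

theorem matrixVal_add_aux {a₀ a₁ b₀ b₁ c : M} (h : a₀ + a₁ + c = b₀ + b₁ + c)
    {i₀ i₁ j₀ j₁ i₀' i₁' j₀' j₁' : ℕ} (h₀₀ : i₀ + j₀ = i₀' + j₀') (h₀₁ : i₀ + j₁ = i₀' + j₁')
    (h₁₀ : i₁ + j₀ = i₁' + j₀') (hi : i₀ ≤ i₀') :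
    i₀ • a₀ + i₁ • a₁ + j₀ • b₀ + j₁ • b₁ + c =
      i₀' • a₀ + i₁' • a₁ + j₀' • b₀ + j₁' • b₁ + c := by
  obtain ⟨t, rfl⟩ := Nat.exists_eq_add_of_le hi
  obtain rfl : i₁' = i₁ + t := by omega
  obtain rfl : j₀ = j₀' + t := by omega
  obtain rfl : j₁ = j₁' + t := by omega
  have := congrArg (i₀ • a₀ + i₁ • a₁ + j₀' • b₀ + j₁' • b₁ + ·) (nsmul_add_eq_of_add_eq h t)
  simp only [nsmul_add] at this
  simp only [add_nsmul]
  calc _ = _ := by abel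
    _ = _ := this.symm
    _ = _ := by abel

theorem matrixVal_add {a₀ a₁ b₀ b₁ c : M} (h : a₀ + a₁ + c = b₀ + b₁ + c)
    {i₀ i₁ j₀ j₁ : ℕ} :
    matrixVal a₀ a₁ b₀ b₁ (i₀ + j₀, i₀ + j₁, i₁ + j₀, i₁ + j₁) + c =
      i₀ • a₀ + i₁ • a₁ + j₀ • b₀ + j₁ • b₁ + c := by
  refine (matrixVal_add_aux h ?_ ?_ ?_ ?_).symm <;> dsimp only <;> omega

theorem matrixVal_balanced_add {a₀ a₁ b₀ b₁ c : M} (h : a₀ + a₁ + c = b₀ + b₁ + c)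
    {m m' : ℕ × ℕ × ℕ × ℕ} (hm : m.1 + m.2.2.2 = m.2.1 + m.2.2.1)
    (hm' : m'.1 + m'.2.2.2 = m'.2.1 + m'.2.2.1) :
    matrixVal a₀ a₁ b₀ b₁ (m + m') + c =
      matrixVal a₀ a₁ b₀ b₁ m + matrixVal a₀ a₁ b₀ b₁ m' + c := by
  obtain ⟨m₁, m₂, m₃, m₄⟩ := m
  obtain ⟨m₁', m₂', m₃', m₄'⟩ := m'
  dsimp only at hm hm'
  have := matrixVal_add h (i₀ := min m₁ m₂ + min m₁' m₂') (i₁ := min m₃ m₄ + min m₃' m₄')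
    (j₀ := (m₁ - m₂) + (m₁' - m₂')) (j₁ := (m₂ - m₁) + (m₂' - m₁'))
  rw [show ((m₁, m₂, m₃, m₄) + (m₁', m₂', m₃', m₄') : ℕ × ℕ × ℕ × ℕ) =
    (min m₁ m₂ + min m₁' m₂' + (m₁ - m₂ + (m₁' - m₂')),
      min m₁ m₂ + min m₁' m₂' + (m₂ - m₁ + (m₂' - m₁')),
      min m₃ m₄ + min m₃' m₄' + (m₁ - m₂ + (m₁' - m₂')),
      min m₃ m₄ + min m₃' m₄' + (m₂ - m₁ + (m₂' - m₁'))) from by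
        simp only [Prod.mk_add_mk, Prod.mk.injEq]
        omega, this]
  simp only [matrixVal, add_nsmul]
  abel

/-- The unit matrices, shifted by the elements of size `2` of the positive cone of `ℤ × ℤ` for the
linear form `4 * k + n`, refine the equation `a₀ + e + (a₁ + e) = b₀ + e + (b₁ + e)`. -/
def refinement (hM : IsConical M) {a₀ a₁ b₀ b₁ e : M} (he : e ≠ 0)
    (h : a₀ + a₁ + 2 • e = b₀ + b₁ + 2 • e) : Gadget M where
  A := (ℕ × ℕ × ℕ × ℕ) × ℤ × ℤ
  S :=
    { carrier := {t | t = 0 ∨ (t.1.1 + t.1.2.1 + t.1.2.2.1 + t.1.2.2.2 : ℤ) < 4 * t.2.1 + t.2.2}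
      zero_mem' := Or.inl rfl
      add_mem' := by
        rintro s t (rfl | hs) (rfl | ht)
        · exact Or.inl (add_zero 0)
        · exact Or.inr (by simpa using ht)
        · exact Or.inr (by simpa using hs)
        · refine Or.inr ?_
          simp only [Prod.fst_add, Prod.snd_add]
          push_cast
          linarith }
  deg :=
    { toFun := fun t => (t.1.1 + t.1.2.2.2 - t.1.2.1 - t.1.2.2.1, t.2.2)
      map_zero' := by simp
      map_add' := fun s t => by
        ext
        · simp
          ring
        · simp }
  val t := matrixVal a₀ a₁ b₀ b₁ t.1 + t.2.1.toNat • e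
  gradedExt := by
    refine ⟨by simp [matrixVal], ?_, ?_, ?_, ?_⟩
    · rintro ⟨⟨m, k, n⟩, hs⟩ ⟨⟨m', k', n'⟩, hs'⟩ d d'
      by_cases hm : (m, k, n) = 0
      · obtain ⟨rfl, rfl, rfl⟩ : m = 0 ∧ k = 0 ∧ n = 0 := by simpa using hm
        simp [matrixVal]
      by_cases hm' : (m', k', n') = 0
      · obtain ⟨rfl, rfl, rfl⟩ : m' = 0 ∧ k' = 0 ∧ n' = 0 := by simpa using hm'
        simp [matrixVal]
      replace hs := hs.resolve_left hm
      replace hs' := hs'.resolve_left hm'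
      simp only [AddMonoidHom.coe_comp, Function.comp_apply, AddSubmonoid.coe_subtype,
        AddMonoidHom.coe_mk, ZeroHom.coe_mk, Prod.mk_eq_zero] at d d' hs hs'
      obtain ⟨r, hr⟩ : ∃ r, k.toNat + k'.toNat = 2 + r :=
        Nat.exists_eq_add_of_le (by omega)
      have hv := matrixVal_balanced_add h (m := m) (m' := m') (by omega) (by omega)
      change matrixVal a₀ a₁ b₀ b₁ (m + m') + (k + k').toNat • e =
        matrixVal a₀ a₁ b₀ b₁ m + k.toNat • e + (matrixVal a₀ a₁ b₀ b₁ m' + k'.toNat • e)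
      rw [Int.toNat_add (by omega) (by omega), add_add_add_comm _ (k.toNat • e), ← add_nsmul, hr,
        add_nsmul, ← add_assoc, hv, add_assoc]
    · rintro ⟨⟨⟨m₁, m₂, m₃, m₄⟩, k, n⟩, hs⟩ ⟨⟨⟨m₁', m₂', m₃', m₄'⟩, k', n'⟩, hs'⟩ d d'
      simp at d d' hs hs' ⊢
      exact hM.add_ne_zero_right (hM.nsmul_ne_zero he (by omega)) _
    · rintro ⟨⟨⟨m₁, m₂, m₃, m₄⟩, k, n⟩, hs⟩ d
      simp at d hs
      refine ⟨5, by norm_num, ⟨((0, 0, 0, 0), 1, 0), Or.inr (by simp)⟩,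
        ⟨((5 * m₁, 5 * m₂, 5 * m₃, 5 * m₄), 5 * k - 1, 5 * n), Or.inr ?_⟩, ?_, ?_, ?_⟩
      · dsimp only
        push_cast
        omega
      · ext <;> simp
      · simp
      · simpa [matrixVal] using he
    · rintro ⟨⟨⟨m₁, m₂, m₃, m₄⟩, k, n⟩, hs⟩
      refine ⟨⟨((m₂, m₁, m₄, m₃), 1 + (m₁ + m₂ + m₃ + m₄) + n ^ 2, -n), Or.inr ?_⟩, ?_⟩
      · dsimp only
        nlinarith [sq_nonneg (n - 1)]
      · simp
        ring

end Gadget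

/-- All instances in `M` of three existence problems are solved in `N`: splitting an element,
finding a nonzero lower bound of two elements, and refining an equation. -/
structure SolvesProblems {M N : Type u} [AddCommMonoid M] [AddCommMonoid N] (f : M →+ N) :
    Prop where
  split : ∀ e, e ≠ 0 → ∃ u v, 2 • u + 3 • v = f e
  lowerBound : ∀ a b, a ≠ 0 → b ≠ 0 → ∃ c a' b', c ≠ 0 ∧ f a = c + a' ∧ f b = c + b'
  refine : ∀ a₀ a₁ b₀ b₁ e, e ≠ 0 → a₀ + a₁ + 2 • e = b₀ + b₁ + 2 • e →
    ∃ c₀₀ c₀₁ c₁₀ c₁₁, f (a₀ + e) = c₀₀ + c₀₁ ∧ f (a₁ + e) = c₁₀ + c₁₁ ∧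
      f (b₀ + e) = c₀₀ + c₁₀ ∧ f (b₁ + e) = c₀₁ + c₁₁

namespace SolvesProblems

variable {N : Type u} [AddCommMonoid N]

theorem isQuasiDivisible (h : SolvesProblems (AddMonoidHom.id N)) : IsQuasiDivisible N := by
  intro x
  rcases eq_or_ne x 0 with rfl | hx
  · exact ⟨0, 0, by simp⟩
  · exact h.split x hx

theorem isRefinementMonoid (h : SolvesProblems (AddMonoidHom.id N)) : IsRefinementMonoid N := by
  intro a₀ a₁ b₀ b₁ hab
  rcases eq_or_ne a₀ 0 with rfl | ha₀
  · exact ⟨0, 0, b₀, b₁, by simpa using hab⟩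
  rcases eq_or_ne a₁ 0 with rfl | ha₁
  · exact ⟨b₀, b₁, 0, 0, by simpa using hab⟩
  rcases eq_or_ne b₀ 0 with rfl | hb₀
  · exact ⟨0, a₀, 0, a₁, by simpa using hab.symm⟩
  rcases eq_or_ne b₁ 0 with rfl | hb₁
  · exact ⟨a₀, 0, a₁, 0, by simpa using hab.symm⟩
  obtain ⟨c, a₀', a₁', hc, hca₀, hca₁⟩ := h.lowerBound a₀ a₁ ha₀ ha₁
  obtain ⟨d, b₀', b₁', hd, hdb₀, hdb₁⟩ := h.lowerBound b₀ b₁ hb₀ hb₁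
  obtain ⟨e, c', d', he, hec, hed⟩ := h.lowerBound c d hc hd
  simp only [AddMonoidHom.id_apply] at hca₀ hca₁ hdb₀ hdb₁ hec hed
  have key : c' + a₀' + (c' + a₁') + 2 • e = d' + b₀' + (d' + b₁') + 2 • e := by
    rw [hca₀, hca₁, hdb₀, hdb₁, hec, hed] at hab
    rw [two_nsmul]
    calc _ = e + c' + a₀' + (e + c' + a₁') := by abel
      _ = _ := hab
      _ = _ := by abel
  have := h.refine _ _ _ _ e he key
  simp only [AddMonoidHom.id_apply] at this
  rwa [show c' + a₀' + e = a₀ by rw [hca₀, hec]; abel,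
    show c' + a₁' + e = a₁ by rw [hca₁, hec]; abel,
    show d' + b₀' + e = b₀ by rw [hdb₀, hed]; abel,
    show d' + b₁' + e = b₁ by rw [hdb₁, hed]; abel] at this

end SolvesProblems

/-- A bundled simple `P`-torsion-free cone. -/
structure SimpleCone (P : Set ℕ) where
  carrier : Type u
  [inst : AddCommMonoid carrier]
  isConical : IsConical carrier
  isSimpleMonoid : IsSimpleMonoid carrier
  pTorsionFree : PTorsionFree P carrier

attribute [instance] SimpleCone.inst

theorem SimpleCone.exists_solvesProblems {P : Set ℕ} (hPpos : ∀ p ∈ P, 0 < p)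
    (C : SimpleCone.{u} P) : ∃ (D : SimpleCone.{u} P) (f : C.carrier →+ D.carrier),
      IsStronglyUnitary f ∧ SolvesProblems f := by
  obtain ⟨M, hM, hMs, hMtf⟩ := C
  have hle : ∀ q : {q : M × M // q.1 ≠ 0 ∧ q.2 ≠ 0},
      ∃ (p : ℕ) (h : M), 0 < p ∧ p • q.1.2 = q.1.1 + h := by
    rintro ⟨⟨a, b⟩, ha, hb⟩
    obtain ⟨p, hp, h, hab⟩ := hMs b (hM.not_algLE_zero_iff.2 hb) a
    exact ⟨p, h, hp, hab.symm⟩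
  choose p h hp hab using hle
  let G : {e : M // e ≠ 0} ⊕ {q : M × M // q.1 ≠ 0 ∧ q.2 ≠ 0} ⊕
      {q : M × M × M × M × M // q.2.2.2.2 ≠ 0 ∧
        q.1 + q.2.1 + 2 • q.2.2.2.2 = q.2.2.1 + q.2.2.2.1 + 2 • q.2.2.2.2} → Gadget M :=
    Sum.elim (fun e => Gadget.splitting hM e.2) <| Sum.elim
      (fun q => Gadget.lowerBound hM q.2.1 q.2.2 (hp q) (hab q))
      (fun q => Gadget.refinement hM q.2.1 q.2.2)
  obtain ⟨N, _, hN, hNs, hNtf, f, hf, hG⟩ := Gadget.exists_extension hPpos hM hMs hMtf G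
  refine ⟨⟨N, hN, hNs, hNtf⟩, f, hf, ⟨fun e he => ?_, fun a b ha hb => ?_,
    fun a₀ a₁ b₀ b₁ e he h => ?_⟩⟩
  · obtain ⟨g, hg, -⟩ := hG (.inl ⟨e, he⟩)
    change (Gadget.splitting hM he).S →+ N at g
    let u : (Gadget.splitting hM he).S := ⟨((2, -9) : ℤ × ℤ), Or.inr (by decide)⟩
    let v : (Gadget.splitting hM he).S := ⟨((-1, 6) : ℤ × ℤ), Or.inr (by decide)⟩
    refine ⟨g u, g v, ?_⟩
    rw [← map_nsmul, ← map_nsmul, ← map_add]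
    refine (hg (2 • u + 3 • v) rfl).trans (congrArg f ?_)
    exact one_nsmul e
  · obtain ⟨g, hg, hg'⟩ := hG (.inr (.inl ⟨(a, b), ha, hb⟩))
    have hp' : 0 < p ⟨(a, b), ha, hb⟩ := hp _
    have hab' : p ⟨(a, b), ha, hb⟩ • b = a + h ⟨(a, b), ha, hb⟩ := hab _
    change (Gadget.lowerBound hM ha hb hp' hab').S →+ N at g
    let c : (Gadget.lowerBound hM ha hb hp' hab').S :=
      ⟨((0, 0, 1) : ℤ × ℤ × ℤ), Or.inr ⟨le_rfl, by simp⟩⟩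
    let a' : (Gadget.lowerBound hM ha hb hp' hab').S :=
      ⟨((1, 0, -1) : ℤ × ℤ × ℤ), Or.inr ⟨le_rfl, by dsimp only; omega⟩⟩
    let b' : (Gadget.lowerBound hM ha hb hp' hab').S :=
      ⟨((0, 1, -1) : ℤ × ℤ × ℤ), Or.inr ⟨zero_le_one, by simp⟩⟩
    refine ⟨g c, g a', g b', hg' c ?_, ?_, ?_⟩
    · change ((1, 0) : ℤ × ℤ) ≠ 0
      decide
    · rw [← map_add]
      refine ((hg (c + a') rfl).trans (congrArg f ?_)).symm
      change (1 : ℤ).toNat • a + ((0 : ℤ) - _ * (-1 : ℤ).toNat).toNat • b +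
        (-1 : ℤ).toNat • h ⟨(a, b), ha, hb⟩ = a
      simp
    · rw [← map_add]
      refine ((hg (c + b') rfl).trans (congrArg f ?_)).symm
      change (0 : ℤ).toNat • a + ((1 : ℤ) - _ * (-0 : ℤ).toNat).toNat • b +
        (-0 : ℤ).toNat • h ⟨(a, b), ha, hb⟩ = b
      simp
  · obtain ⟨g, hg, -⟩ := hG (.inr (.inr ⟨(a₀, a₁, b₀, b₁, e), he, h⟩))
    change (Gadget.refinement hM he h).S →+ N at g
    let c₀₀ : (Gadget.refinement hM he h).S :=
      ⟨(((1, 0, 0, 0), 0, 2) : (ℕ × ℕ × ℕ × ℕ) × ℤ × ℤ), Or.inr (by decide)⟩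
    let c₀₁ : (Gadget.refinement hM he h).S :=
      ⟨(((0, 1, 0, 0), 1, -2) : (ℕ × ℕ × ℕ × ℕ) × ℤ × ℤ), Or.inr (by decide)⟩
    let c₁₀ : (Gadget.refinement hM he h).S :=
      ⟨(((0, 0, 1, 0), 1, -2) : (ℕ × ℕ × ℕ × ℕ) × ℤ × ℤ), Or.inr (by decide)⟩
    let c₁₁ : (Gadget.refinement hM he h).S :=
      ⟨(((0, 0, 0, 1), 0, 2) : (ℕ × ℕ × ℕ × ℕ) × ℤ × ℤ), Or.inr (by decide)⟩
    refine ⟨g c₀₀, g c₀₁, g c₁₀, g c₁₁, ?_, ?_, ?_, ?_⟩ <;> rw [← map_add]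
    · refine ((hg (c₀₀ + c₀₁) rfl).trans (congrArg f ?_)).symm
      change Gadget.matrixVal a₀ a₁ b₀ b₁ (1, 1, 0, 0) + 1 • e = _
      simp [Gadget.matrixVal]
    · refine ((hg (c₁₀ + c₁₁) rfl).trans (congrArg f ?_)).symm
      change Gadget.matrixVal a₀ a₁ b₀ b₁ (0, 0, 1, 1) + 1 • e = _
      simp [Gadget.matrixVal]
    · refine ((hg (c₀₀ + c₁₀) rfl).trans (congrArg f ?_)).symm
      change Gadget.matrixVal a₀ a₁ b₀ b₁ (1, 0, 1, 0) + 1 • e = _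
      simp [Gadget.matrixVal]
    · refine ((hg (c₀₁ + c₁₁) rfl).trans (congrArg f ?_)).symm
      change Gadget.matrixVal a₀ a₁ b₀ b₁ (0, 1, 0, 1) + 1 • e = _
      simp [Gadget.matrixVal]

theorem exists_sequential_union {F : ℕ → Type u} [∀ n, AddCommMonoid (F n)]
    {f : ∀ n, F n →+ F (n + 1)} (hf : ∀ n, Function.Injective (f n)) :
    ∃ (N : Type u) (_ : AddCommMonoid N) (g : ∀ n, F n →+ N), (∀ n, Function.Injective (g n)) ∧
      (∀ n x, g (n + 1) (f n x) = g n x) ∧ ∀ x, ∃ n y, g n y = x := by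
  let φ : ∀ i j, i ≤ j → F i →+ F j := fun i j h =>
    Nat.leRec (motive := fun j _ => F i →+ F j) (AddMonoidHom.id _)
      (fun j _ ψ => (f j).comp ψ) h
  have φ_self : ∀ i, φ i i le_rfl = AddMonoidHom.id _ := fun i => Nat.leRec_self _ _
  have φ_succ : ∀ i j (h : i ≤ j), φ i (j + 1) (Nat.le_succ_of_le h) = (f j).comp (φ i j h) :=
    fun i j h => Nat.leRec_succ _ _ h
  have φ_inj : ∀ i j h, Function.Injective (φ i j h) := by
    intro i j h
    induction j, h using Nat.le_induction with
    | base => rw [φ_self]; exact Function.injective_id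
    | succ j h ih => rw [φ_succ i j h]; exact (hf j).comp ih
  have : DirectedSystem F (φ · · ·) :=
    { map_self := fun i x => by rw [φ_self]; rfl
      map_map := fun k j i hij hjk x => by
        induction k, hjk using Nat.le_induction with
        | base => rw [φ_self]; rfl
        | succ k h ih =>
          rw [φ_succ j k h, φ_succ i k (hij.trans h), AddMonoidHom.comp_apply, ih]
          rfl }
  refine ⟨DirectLimit F φ, inferInstance, fun n =>
    { toFun := fun x => ⟦⟨n, x⟩⟧
      map_zero' := (DirectLimit.zero_def n).symm
      map_add' := fun x y => (DirectLimit.add_def n x y).symm },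
    fun n => DirectLimit.mk_injective φ φ_inj n, fun n x => ?_, fun x => ?_⟩
  · have := DirectLimit.mk_apply (f := φ) n (n + 1) x (Nat.le_succ n)
    rw [φ_succ n n le_rfl, φ_self] at this
    exact this
  · obtain ⟨n, y, rfl⟩ := DirectLimit.exists_eq_mk φ x
    exact ⟨n, y, rfl⟩

theorem SimpleCone.exists_chain {P : Set ℕ} (hPpos : ∀ p ∈ P, 0 < p) (C₀ : SimpleCone.{u} P) :
    ∃ (C : ℕ → SimpleCone.{u} P) (f : ∀ n, (C n).carrier →+ (C (n + 1)).carrier),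
      C 0 = C₀ ∧ (∀ n, IsStronglyUnitary (f n)) ∧ ∀ n, SolvesProblems (f n) := by
  choose next f hf hf' using SimpleCone.exists_solvesProblems.{u} hPpos
  exact ⟨fun n => Nat.rec C₀ (fun _ => next) n, fun n => f _, rfl, fun n => hf _, fun n => hf' _⟩

theorem SimpleCone.exists_isStronglyUnitary {P : Set ℕ} (hPpos : ∀ p ∈ P, 0 < p)
    (C₀ : SimpleCone.{u} P) :
    ∃ (N : Type u) (_ : AddCommMonoid N),
      IsConical N ∧ IsSimpleMonoid N ∧ PTorsionFree P N ∧
      IsQuasiDivisible N ∧ IsRefinementMonoid N ∧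
      ∃ f : C₀.carrier →+ N, IsStronglyUnitary f := by
  obtain ⟨C, step, rfl, hstep, hsolve⟩ := C₀.exists_chain hPpos
  obtain ⟨N, _, g, hg, hgs, hgN⟩ := exists_sequential_union (F := fun n => (C n).carrier)
    (f := step) (fun n => (hstep n).1.1)
  have hmem : ∀ x : N, ∀ᶠ n in Filter.atTop, ∃ y, g n y = x := by
    intro x
    obtain ⟨n, y, rfl⟩ := hgN x
    refine Filter.eventually_atTop.2 ⟨n, fun m hm => ?_⟩
    induction m, hm using Nat.le_induction with
    | base => exact ⟨y, rfl⟩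
    | succ m h ih =>
      obtain ⟨z, hz⟩ := ih
      exact ⟨step m z, (hgs m z).trans hz⟩
  have hconical : IsConical N := by
    intro x y hxy
    obtain ⟨n, ⟨x, rfl⟩, y, rfl⟩ := ((hmem x).and (hmem y)).exists
    obtain ⟨rfl, rfl⟩ := (C n).isConical x y (hg n (by simpa using hxy))
    simp
  have hsolves : SolvesProblems (AddMonoidHom.id N) := by
    refine ⟨fun e he => ?_, fun a b ha hb => ?_, fun a₀ a₁ b₀ b₁ e he h => ?_⟩
    · obtain ⟨n, e, rfl⟩ := (hmem e).exists
      obtain ⟨u, v, h⟩ := (hsolve n).split e (by rintro rfl; simp at he)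
      refine ⟨g (n + 1) u, g (n + 1) v, ?_⟩
      rw [AddMonoidHom.id_apply, ← hgs n e, ← h]
      simp
    · obtain ⟨n, ⟨a, rfl⟩, b, rfl⟩ := ((hmem a).and (hmem b)).exists
      obtain ⟨c, a', b', hc, h, h'⟩ := (hsolve n).lowerBound a b (by rintro rfl; simp at ha)
        (by rintro rfl; simp at hb)
      refine ⟨g (n + 1) c, g (n + 1) a', g (n + 1) b', ?_, ?_, ?_⟩
      · rwa [Ne, map_eq_zero_iff _ (hg (n + 1))]
      · rw [AddMonoidHom.id_apply, ← hgs, h, map_add]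
      · rw [AddMonoidHom.id_apply, ← hgs, h', map_add]
    · obtain ⟨n, ⟨⟨a₀, rfl⟩, a₁, rfl⟩, ⟨⟨b₀, rfl⟩, b₁, rfl⟩, e, rfl⟩ :=
        (((hmem a₀).and (hmem a₁)).and (((hmem b₀).and (hmem b₁)).and (hmem e))).exists
      obtain ⟨c₀₀, c₀₁, c₁₀, c₁₁, h₀, h₁, h₂, h₃⟩ := (hsolve n).refine a₀ a₁ b₀ b₁ e
        (by rintro rfl; simp at he) (hg n (by simpa using h))
      refine ⟨g (n + 1) c₀₀, g (n + 1) c₀₁, g (n + 1) c₁₀, g (n + 1) c₁₁, ?_, ?_, ?_, ?_⟩ <;>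
        rw [AddMonoidHom.id_apply, ← map_add, ← hgs, ← map_add]
      · rw [h₀]
      · rw [h₁]
      · rw [h₂]
      · rw [h₃]
  have hunit : ∀ n, ∃ j : (C 0).carrier →+ (C n).carrier, IsStronglyUnitary j ∧ (g n).comp j = g 0 := by
    intro n
    induction n with
    | zero => exact ⟨AddMonoidHom.id (C 0).carrier, IsStronglyUnitary.id, rfl⟩
    | succ n ih =>
      obtain ⟨j, hj, h⟩ := ih
      refine ⟨(step n).comp j, (hstep n).comp hj, ?_⟩
      rw [← h]
      ext x
      exact hgs n (j x)
  refine ⟨N, inferInstance, hconical, ?_, ?_, hsolves.isQuasiDivisible,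
    hsolves.isRefinementMonoid, g 0, ⟨hg 0, ?_, ?_⟩, ?_⟩
  · intro u hu x
    obtain ⟨n, ⟨u, rfl⟩, x, rfl⟩ := ((hmem u).and (hmem x)).exists
    obtain ⟨k, hk, h⟩ := (C n).isSimpleMonoid u
      (fun h => hu (by simpa using h.map (g n))) x
    exact ⟨k, hk, by simpa using h.map (g n)⟩
  · intro p hp x y hxy
    obtain ⟨n, ⟨x, rfl⟩, y, rfl⟩ := ((hmem x).and (hmem y)).exists
    rw [(C n).pTorsionFree p hp x y (hg n (by simpa using hxy))]
  · intro b
    obtain ⟨n, b, rfl⟩ := (hmem b).exists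
    obtain ⟨j, hj, h⟩ := hunit n
    obtain ⟨a, ha⟩ := hj.1.2.1 b
    exact ⟨a, by rw [← h]; exact ha.map (g n)⟩
  · intro a₀ a₁ b hb
    obtain ⟨n, b, rfl⟩ := (hmem b).exists
    obtain ⟨j, hj, h⟩ := hunit n
    rw [← h] at hb ⊢
    obtain ⟨a, rfl⟩ := hj.1.2.2 a₀ a₁ b (hg n (by simpa using hb))
    exact ⟨a, rfl⟩
  · rintro m hm b ⟨a, ha⟩
    obtain ⟨n, b, rfl⟩ := (hmem b).exists
    obtain ⟨j, hj, h⟩ := hunit n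
    rw [← h] at ha ⊢
    obtain ⟨a', rfl⟩ := hj.2 m hm b ⟨a, hg n (by simpa using ha)⟩
    exact ⟨a', rfl⟩

/-- Every simple `ℙ`-torsion-free cone admits a strongly unitary embedding
into a simple `ℙ`-torsion-free quasi-divisible refinement cone. -/
theorem simple_PTorsionFree_cone_stronglyUnitary_embeds
    (P : Set ℕ) (hPpos : ∀ p ∈ P, 0 < p) (hPmul : ∀ p ∈ P, ∀ q ∈ P, p * q ∈ P)
    (hP : ∃ p ∈ P, 1 < p)
    (M : Type u) [AddCommMonoid M] (hM : IsConical M)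
    (hMtf : PTorsionFree P M) (hMs : IsSimpleMonoid M) :
    ∃ (N : Type u) (_ : AddCommMonoid N),
      IsConical N ∧ IsSimpleMonoid N ∧ PTorsionFree P N ∧
      IsQuasiDivisible N ∧ IsRefinementMonoid N ∧
      ∃ f : M →+ N, IsStronglyUnitary f := by
  exact SimpleCone.exists_isStronglyUnitary hPpos ⟨M, hM, hMs, hMtf⟩
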